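/- For every finite n ≥ 3, the free group Fₙ of rank n is not ∀-homogeneous: there exist finite tuples ā and b̄ in Fₙ of the same length with tp_∀^{Fₙ}(ā) = tp_∀^{Fₙ}(b̄) such that no automorphism of Fₙ sends ā to b̄. -/

import Mathlib

open FirstOrder

/-- Function symbols of the first-order language of groups: a constant for the identity,
a unary symbol for inversion, and a binary symbol for multiplication. -/
inductive GroupFn : ℕ → Type
  | one : GroupFn 0
  | inv : GroupFn 1
  | mul : GroupFn 2

/-- The first-order language of groups. -/
def Lgp : Language := ⟨GroupFn, fun _ => Empty⟩

/-- Every group is an `Lgp`-structure in the natural way. -/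
instance (priority := 100) groupLgpStructure (G : Type*) [Group G] : Lgp.Structure G where
  funMap {_} f x :=
    match f with
    | .one => 1
    | .inv => (x 0)⁻¹
    | .mul => x 0 * x 1
  RelMap {_} r := Empty.elim r

/-- A formula is universal if it is (syntactically) a block of universal quantifiers applied
to a quantifier-free formula. -/
def IsUniversalF {α : Type*} (φ : Lgp.Formula α) : Prop :=
  ∃ (n : ℕ) (ψ : Lgp.BoundedFormula α n), ψ.IsQF ∧ φ = ψ.alls


set_option linter.unusedSimpArgs false

/-! ### Logic -/

theorem term_hom {F : Type*} [Group F] (f : F →* F) {α : Type*} (v : α → F) (s : Lgp.Term α) :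
    s.realize (fun i => f (v i)) = f (s.realize v) := by
  induction s with
  | var i => rfl
  | func g ts ih =>
    simp only [Language.Term.realize, ih]
    cases g with
    | one => exact (map_one f).symm
    | inv => exact (map_inv f _).symm
    | mul => exact (map_mul f _ _).symm

theorem qf_discr {F : Type*} [Group F] (f : ℕ → F →* F)
    (hf : ∀ g : F, g ≠ 1 → ∀ᶠ k in Filter.atTop, f k g ≠ 1)
    {α : Type*} {m : ℕ} (ψ : Lgp.BoundedFormula α m) (hψ : ψ.IsQF) (v : α → F) (w : Fin m → F) :
    ∀ᶠ k in Filter.atTop,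
      (ψ.Realize (fun i => f k (v i)) (fun i => f k (w i)) ↔ ψ.Realize v w) := by
  induction hψ with
  | falsum => exact Filter.Eventually.of_forall fun _ => Iff.rfl
  | of_isAtomic h =>
    cases h with
    | equal t₁ t₂ =>
      have key : ∀ k, ∀ s : Lgp.Term (α ⊕ Fin m),
          s.realize (Sum.elim (fun i => f k (v i)) (fun i => f k (w i))) =
            f k (s.realize (Sum.elim v w)) := by
        intro k s
        rw [← term_hom]
        congr 1
        funext i
        cases i <;> rfl
      simp only [Language.BoundedFormula.realize_bdEqual, key]
      by_cases h : t₁.realize (Sum.elim v w) = t₂.realize (Sum.elim v w)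
      · simp [h]
      · have := hf (t₁.realize (Sum.elim v w) * (t₂.realize (Sum.elim v w))⁻¹)
          (fun h' => h (mul_inv_eq_one.1 h'))
        filter_upwards [this] with k hk
        simp only [h, iff_false]
        intro h'
        apply hk
        rw [map_mul, map_inv, h', mul_inv_cancel]
    | rel R ts => exact Empty.elim R
  | imp h₁ h₂ ih₁ ih₂ =>
    filter_upwards [ih₁, ih₂] with k h1 h2
    simp only [Language.BoundedFormula.realize_imp, h1, h2]

theorem univ_transfer {F : Type*} [Group F] (f : ℕ → F →* F)
    (hf : ∀ g : F, g ≠ 1 → ∀ᶠ k in Filter.atTop, f k g ≠ 1)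
    {α : Type*} (a b : α → F) (hab : ∀ k i, f k (b i) = a i)
    (φ : Lgp.Formula α) (hφ : IsUniversalF φ) (h : φ.Realize a) : φ.Realize b := by
  obtain ⟨m, ψ, hψ, rfl⟩ := hφ
  rw [Language.BoundedFormula.realize_alls] at h ⊢
  intro xs
  obtain ⟨k, hk⟩ := (qf_discr f hf ψ hψ b xs).exists
  rw [← hk]
  have : (fun i => f k (b i)) = a := funext (hab k)
  rw [this]
  exact h _

/-! ### Counting -/

section Count
variable (n : ℕ) (hn : 3 ≤ n)

def xp : FreeGroup (Fin n) := FreeGroup.of ⟨0, by omega⟩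
def xq : FreeGroup (Fin n) := FreeGroup.of ⟨1, by omega⟩
def xt : FreeGroup (Fin n) := FreeGroup.of ⟨2, by omega⟩

def elA : FreeGroup (Fin n) := xp n hn * xq n hn * xp n hn * xq n hn ^ 2
def elB : FreeGroup (Fin n) :=
  xp n hn * (xt n hn)⁻¹ * xp n hn * xq n hn ^ 3 * xt n hn

set_option maxRecDepth 100000 in
theorem count_S3 : Fintype.card {h : Fin 3 → Equiv.Perm (Fin 3) // h 0 * h 1 * h 0 * h 1 ^ 2 = 1} <
   Fintype.card {h : Fin 3 → Equiv.Perm (Fin 3) //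
      h 0 * (h 2)⁻¹ * h 0 * h 1 ^ 3 * h 2 = 1} := by
  decide +kernel

theorem no_auto (e : FreeGroup (Fin n) ≃* FreeGroup (Fin n)) : e (elA n hn) ≠ elB n hn := by
  intro he
  obtain ⟨m, rfl⟩ := Nat.exists_eq_add_of_le hn
  let S := Equiv.Perm (Fin 3)
  let E : {h : Fin (3 + m) → S // FreeGroup.lift h (elB _ hn) = 1} ≃
      {h : Fin (3 + m) → S // FreeGroup.lift h (elA _ hn) = 1} :=
    (Equiv.subtypeEquiv (p := fun h => FreeGroup.lift h (elB _ hn) = 1)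
      (q := fun f : FreeGroup (Fin (3 + m)) →* S => f (elB _ hn) = 1) FreeGroup.lift
        (fun _ => Iff.rfl)).trans <|
    (Equiv.subtypeEquiv (p := fun f : FreeGroup (Fin (3 + m)) →* S => f (elB _ hn) = 1)
      (q := fun f : FreeGroup (Fin (3 + m)) →* S => f (elA _ hn) = 1)
      (MulEquiv.monoidHomCongrLeftEquiv e.symm) (by
        intro f
        simp [← he])).trans <|
    (Equiv.subtypeEquiv (p := fun h => FreeGroup.lift h (elA _ hn) = 1)
      (q := fun f : FreeGroup (Fin (3 + m)) →* S => f (elA _ hn) = 1) FreeGroup.lift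
        (fun _ => Iff.rfl)).symm
  have split : ∀ P : (Fin 3 → S) → Prop,
      Nat.card {h : Fin (3 + m) → S // P (fun i => h (Fin.castAdd m i))} =
        Nat.card {h : Fin 3 → S // P h} * Nat.card (Fin m → S) := by
    intro P
    rw [← Nat.card_prod]
    refine Nat.card_congr ?_
    refine (Equiv.subtypeEquiv (p := fun h => P (fun i => h (Fin.castAdd m i)))
      (q := fun x : (Fin 3 → S) × (Fin m → S) => P x.1) (Fin.appendEquiv 3 m).symm ?_).trans
      (Equiv.prodSubtypeFstEquivSubtypeProd (p := P))
    intro h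
    rfl
  have h1 := split (fun h => h 0 * h 1 * h 0 * h 1 ^ 2 = 1)
  have h2 := split (fun h => h 0 * (h 2)⁻¹ * h 0 * h 1 ^ 3 * h 2 = 1)
  have h3 := Nat.card_congr E
  have eA : ∀ h : Fin (3 + m) → S, FreeGroup.lift h (elA _ hn) =
     (fun h : Fin 3 → S => h 0 * h 1 * h 0 * h 1 ^ 2) (fun i => h (Fin.castAdd m i)) := by
    intro h
    simp [elA, xp, xq]
    rfl
  have eB : ∀ h : Fin (3 + m) → S, FreeGroup.lift h (elB _ hn) =
     (fun h : Fin 3 → S => h 0 * (h 2)⁻¹ * h 0 * h 1 ^ 3 * h 2)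
      (fun i => h (Fin.castAdd m i)) := by
    intro h
    simp [elB, xp, xq, xt]
    rfl
  simp only [eA, eB] at h3
  rw [h1, h2] at h3
  have h4 := count_S3
  rw [← Nat.card_eq_fintype_card, ← Nat.card_eq_fintype_card] at h4
  have h5 : 0 < Nat.card (Fin m → S) := Nat.card_pos
  exact absurd (Nat.eq_of_mul_eq_mul_right h5 h3) h4.ne'

end Count

/-! ### Injectivity through a semidirect product -/

section Semi

/-- The shift action of the integers on the free group over the integers. -/
def shiftAct : Multiplicative ℤ →* MulAut (FreeGroup ℤ) where
  toFun m := FreeGroup.freeGroupCongr (Equiv.addLeft (Multiplicative.toAdd m))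
  map_one' := by
    apply MulEquiv.toMonoidHom_injective
    ext i
    simp
  map_mul' a b := by
    apply MulEquiv.toMonoidHom_injective
    ext i
    simp [add_assoc]

abbrev SD := SemidirectProduct (FreeGroup ℤ) (Multiplicative ℤ) shiftAct

def sdP : SD := SemidirectProduct.inl (FreeGroup.of 0)
def sdT : SD := SemidirectProduct.inr (Multiplicative.ofAdd 1)

theorem sd_conj (m : ℤ) : sdT ^ m * sdP * (sdT ^ m)⁻¹ = SemidirectProduct.inl (FreeGroup.of m) := by
  have : sdT ^ m = SemidirectProduct.inr (Multiplicative.ofAdd m) := by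
    rw [sdT, ← map_zpow, ← ofAdd_zsmul]; simp
  rw [this, ← map_inv, sdP, ← SemidirectProduct.inl_aut]
  congr 1
  simp [shiftAct]

theorem inj_of_sd {ι G : Type*} [Group G] (g : FreeGroup ι →* G) (ψ : G →* SD)
    (c : ι → FreeGroup ℤ) (hc : Function.Injective (FreeGroup.lift c))
    (h : ∀ i, ψ (g (FreeGroup.of i)) = SemidirectProduct.inl (c i)) :
    Function.Injective g := by
  have : ψ.comp g = SemidirectProduct.inl.comp (FreeGroup.lift c) := by
    ext1 i
    simp [h]
  have h2 : Function.Injective (ψ.comp g) := by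
    rw [this, MonoidHom.coe_comp]
    exact SemidirectProduct.inl_injective.comp hc
  rw [MonoidHom.coe_comp] at h2
  exact h2.of_comp

end Semi

section Two
variable (n : ℕ) (hn : 3 ≤ n)

/-- The endomorphism sending the first generator to `elB`. -/
def gB : FreeGroup (Fin n) →* FreeGroup (Fin n) :=
  FreeGroup.lift fun i => if i.1 = 0 then elB n hn else
    xt n hn ^ (i.1 : ℤ) * xp n hn * (xt n hn ^ (i.1 : ℤ))⁻¹

theorem gB_inj : Function.Injective (gB n hn) := by
  let ψ : FreeGroup (Fin n) →* SD := FreeGroup.lift fun i =>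
    if i.1 = 0 then sdP else if i.1 = 2 then sdT else 1
  have hp : ψ (xp n hn) = sdP := by simp [ψ, xp]
  have hq : ψ (xq n hn) = 1 := by simp [ψ, xq]
  have ht : ψ (xt n hn) = sdT := by simp [ψ, xt]
  let c : Fin n → FreeGroup ℤ := fun i =>
    if i.1 = 0 then FreeGroup.of 0 * FreeGroup.of (-1) else FreeGroup.of (i.1 : ℤ)
  refine inj_of_sd _ ψ c ?_ ?_
  · let κ : FreeGroup ℤ →* FreeGroup ℤ :=
      FreeGroup.lift fun j => if j = -1 then 1 else FreeGroup.of j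
    have hk : κ.comp (FreeGroup.lift c) = FreeGroup.map (fun i : Fin n => (i.1 : ℤ)) := by
      ext1 i
      by_cases hi : i.1 = 0
      · simp [c, κ, hi]
      · have : ((i.1 : ℤ)) ≠ -1 := by omega
        simp [c, κ, hi, this]
    have h2 : Function.Injective (κ.comp (FreeGroup.lift c)) := by
      rw [hk]
      apply FreeGroup.map_injective
      intro i j hij
      exact Fin.ext (by simpa using hij)
    rw [MonoidHom.coe_comp] at h2
    exact h2.of_comp
  · intro i
    by_cases hi : i.1 = 0
    · have := sd_conj (-1)
      have h0 : sdP = SemidirectProduct.inl (FreeGroup.of 0) := rfl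
      simp only [zpow_neg, zpow_one, inv_inv] at this
      simp only [gB, FreeGroup.lift_apply_of, hi, if_true, c, elB, map_mul, map_pow, map_inv, hp,
        hq, ht]
      rw [← this, ← h0]
      simp [mul_assoc]
    · simp [gB, hi, c, hp, ht, ← sd_conj]

def beta : FreeGroup (Fin n) →* FreeGroup (Fin n) :=
  FreeGroup.lift fun i => if i.1 = 0 then xq n hn * (xp n hn)⁻¹ * xq n hn ^ 2 else
    if i.1 = 1 then (xq n hn ^ 2)⁻¹ * xp n hn else FreeGroup.of i

def beta' : FreeGroup (Fin n) →* FreeGroup (Fin n) :=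
  FreeGroup.lift fun i => if i.1 = 0 then elA n hn else
    if i.1 = 1 then xp n hn * xq n hn else FreeGroup.of i

theorem beta_p : beta n hn (xp n hn) = xq n hn * (xp n hn)⁻¹ * xq n hn ^ 2 := by
  simp [beta, xp]
theorem beta_q : beta n hn (xq n hn) = (xq n hn ^ 2)⁻¹ * xp n hn := by
  simp [beta, xq]
theorem beta'_p : beta' n hn (xp n hn) = elA n hn := by
  simp [beta', xp]
theorem beta'_q : beta' n hn (xq n hn) = xp n hn * xq n hn := by
  simp [beta', xq]

theorem of_zero (i : Fin n) (hi : i.1 = 0) : FreeGroup.of i = xp n hn := by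
  unfold xp; congr 1; exact Fin.ext hi
theorem of_one (i : Fin n) (hi : i.1 = 1) : FreeGroup.of i = xq n hn := by
  unfold xq; congr 1; exact Fin.ext hi

theorem beta_inj : Function.Injective (beta n hn) := by
  have : (beta' n hn).comp (beta n hn) = MonoidHom.id _ := by
    ext1 i
    by_cases hi : i.1 = 0
    · rw [of_zero n hn i hi]
      simp only [MonoidHom.comp_apply, beta_p, map_mul, map_inv, map_pow, beta'_p, beta'_q, elA,
        MonoidHom.id_apply]
      simp [pow_succ, mul_assoc]
    · by_cases hi1 : i.1 = 1
      · rw [of_one n hn i hi1]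
        simp only [MonoidHom.comp_apply, beta_q, map_mul, map_inv, map_pow, beta'_p, beta'_q, elA,
          MonoidHom.id_apply]
        simp [pow_succ, mul_assoc]
      · simp [beta, beta', hi, hi1]
  intro x y hxy
  have h1 := DFunLike.congr_fun this x
  have h2 := DFunLike.congr_fun this y
  simp only [MonoidHom.comp_apply, MonoidHom.id_apply] at h1 h2
  rw [← h1, ← h2, hxy]

theorem beta_A : beta n hn (elA n hn) = xp n hn := by
  simp only [elA, map_mul, map_pow, beta_p, beta_q]
  simp [pow_succ, mul_assoc]

theorem exists_inj : ∃ f : FreeGroup (Fin n) →* FreeGroup (Fin n), Function.Injective f ∧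
    f (elA n hn) = elB n hn := by
  refine ⟨(gB n hn).comp (beta n hn), ?_, ?_⟩
  · rw [MonoidHom.coe_comp]
    exact (gB_inj n hn).comp (beta_inj n hn)
  · rw [MonoidHom.comp_apply, beta_A]
    simp [gB, xp]

end Two

/-! ### A faithful representation -/

section Rep
open Matrix

abbrev SLZ := Matrix.SpecialLinearGroup (Fin 2) ℤ

def mP : SLZ := ⟨!![1, 3; 0, 1], by simp [det_fin_two]⟩
def mB : SLZ := ⟨!![1, 0; 3, 1], by simp [det_fin_two]⟩

def ppX (i : Fin 2) : Set SLZ := if i = 0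
  then {g | (0 ≤ g 1 0 ∧ g 1 0 < g 0 0) ∨ (g 1 0 ≤ 0 ∧ g 0 0 < g 1 0)}
  else {g | (0 ≤ g 0 0 ∧ g 0 0 < g 1 0) ∨ (g 0 0 ≤ 0 ∧ g 1 0 < g 0 0)}
def ppY (i : Fin 2) : Set SLZ := if i = 0
  then {g | (0 < - g 1 0 ∧ - g 1 0 < g 0 0) ∨ (- g 1 0 < 0 ∧ g 0 0 < - g 1 0)}
  else {g | (0 < - g 0 0 ∧ - g 0 0 < g 1 0) ∨ (- g 0 0 < 0 ∧ g 1 0 < - g 0 0)}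

theorem col_ne (g : SLZ) : g 0 0 ≠ 0 ∨ g 1 0 ≠ 0 := by
  by_contra! h
  have := g.det_coe
  rw [det_fin_two, h.1, h.2] at this
  simp at this

theorem sl_mul (A B : SLZ) (i j : Fin 2) : (A * B) i j = A i 0 * B 0 j + A i 1 * B 1 j :=
  (congrFun (congrFun (Matrix.SpecialLinearGroup.coe_mul A B) i) j).trans
    (by rw [Matrix.mul_apply, Fin.sum_univ_two])
theorem sl_inv00 (A : SLZ) : A⁻¹ 0 0 = A 1 1 :=
  (congrFun (congrFun (Matrix.SpecialLinearGroup.coe_inv A) 0) 0).trans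
    (by rw [Matrix.adjugate_fin_two]; rfl)
theorem sl_inv01 (A : SLZ) : A⁻¹ 0 1 = - A 0 1 :=
  (congrFun (congrFun (Matrix.SpecialLinearGroup.coe_inv A) 0) 1).trans
    (by rw [Matrix.adjugate_fin_two]; rfl)
theorem sl_inv10 (A : SLZ) : A⁻¹ 1 0 = - A 1 0 :=
  (congrFun (congrFun (Matrix.SpecialLinearGroup.coe_inv A) 1) 0).trans
    (by rw [Matrix.adjugate_fin_two]; rfl)
theorem sl_inv11 (A : SLZ) : A⁻¹ 1 1 = A 0 0 :=
  (congrFun (congrFun (Matrix.SpecialLinearGroup.coe_inv A) 1) 1).trans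
    (by rw [Matrix.adjugate_fin_two]; rfl)
theorem sl_det (A : SLZ) : A 0 0 * A 1 1 - A 0 1 * A 1 0 = 1 := by
  rw [← det_fin_two, A.det_coe]
theorem mP00 : mP 0 0 = 1 := rfl
theorem mP01 : mP 0 1 = 3 := rfl
theorem mP10 : mP 1 0 = 0 := rfl
theorem mP11 : mP 1 1 = 1 := rfl
theorem mB00 : mB 0 0 = 1 := rfl
theorem mB01 : mB 0 1 = 0 := rfl
theorem mB10 : mB 1 0 = 3 := rfl
theorem mB11 : mB 1 1 = 1 := rfl

theorem mP_00 (g : SLZ) : (mP * g) 0 0 = g 0 0 + 3 * g 1 0 := by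
  simp only [sl_mul, sl_inv00, sl_inv01, sl_inv10, sl_inv11, mP00, mP01, mP10, mP11]; ring
theorem mP_10 (g : SLZ) : (mP * g) 1 0 = g 1 0 := by
  simp only [sl_mul, sl_inv00, sl_inv01, sl_inv10, sl_inv11, mP00, mP01, mP10, mP11]; ring
theorem mPi_00 (g : SLZ) : (mP⁻¹ * g) 0 0 = g 0 0 - 3 * g 1 0 := by
  simp only [sl_mul, sl_inv00, sl_inv01, sl_inv10, sl_inv11, mP00, mP01, mP10, mP11]; ring
theorem mPi_10 (g : SLZ) : (mP⁻¹ * g) 1 0 = g 1 0 := by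
  simp only [sl_mul, sl_inv00, sl_inv01, sl_inv10, sl_inv11, mP00, mP01, mP10, mP11]; ring
theorem mB_00 (g : SLZ) : (mB * g) 0 0 = g 0 0 := by
  simp only [sl_mul, sl_inv00, sl_inv01, sl_inv10, sl_inv11, mB00, mB01, mB10, mB11]; ring
theorem mB_10 (g : SLZ) : (mB * g) 1 0 = 3 * g 0 0 + g 1 0 := by
  simp only [sl_mul, sl_inv00, sl_inv01, sl_inv10, sl_inv11, mB00, mB01, mB10, mB11]; ring
theorem mBi_00 (g : SLZ) : (mB⁻¹ * g) 0 0 = g 0 0 := by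
  simp only [sl_mul, sl_inv00, sl_inv01, sl_inv10, sl_inv11, mB00, mB01, mB10, mB11]; ring
theorem mBi_10 (g : SLZ) : (mB⁻¹ * g) 1 0 = g 1 0 - 3 * g 0 0 := by
  simp only [sl_mul, sl_inv00, sl_inv01, sl_inv10, sl_inv11, mB00, mB01, mB10, mB11]; ring

theorem sanov_inj : Function.Injective (FreeGroup.lift (![mP, mB] : Fin 2 → SLZ)) := by
  refine FreeGroup.injective_lift_of_ping_pong _ ppX ppY ?_ ?_ ?_ ?_ ?_ ?_
  · intro i
    fin_cases i
    · exact ⟨mP, by simp [ppX, mP00, mP10]⟩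
    · exact ⟨mB, by simp [ppX, mB00, mB10]⟩
  · intro i j hij
    fin_cases i <;> fin_cases j <;> simp [Function.onFun, ppX, Set.disjoint_left] at hij ⊢ <;>
      intros <;> omega
  · intro i j hij
    fin_cases i <;> fin_cases j <;> simp [Function.onFun, ppY, Set.disjoint_left] at hij ⊢ <;>
      intros <;> omega
  · intro i j
    fin_cases i <;> fin_cases j <;> simp [ppX, ppY, Set.disjoint_left] <;>
      intros <;> omega
  · intro i
    rw [Set.smul_set_subset_iff]
    intro g hg
    have hc := col_ne g
    rw [Set.mem_compl_iff] at hg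
    fin_cases i
    · simp only [ppX, ppY, Fin.zero_eta, if_true, Set.mem_ofPred_eq, smul_eq_mul,
        Matrix.cons_val_zero, mP_00, mP_10] at hg ⊢
      omega
    · simp only [ppX, ppY, Fin.mk_one, one_ne_zero, if_false, Set.mem_ofPred_eq, smul_eq_mul,
        Matrix.cons_val_one, Matrix.cons_val_zero, mB_00, mB_10] at hg ⊢
      omega
  · intro i
    rw [Set.smul_set_subset_iff]
    intro g hg
    have hc := col_ne g
    rw [Set.mem_compl_iff] at hg
    fin_cases i
    · simp only [ppX, ppY, Fin.zero_eta, if_true, Set.mem_ofPred_eq, smul_eq_mul, Pi.inv_apply,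
        Matrix.cons_val_zero, mPi_00, mPi_10] at hg ⊢
      omega
    · simp only [ppX, ppY, Fin.mk_one, one_ne_zero, if_false, Set.mem_ofPred_eq, smul_eq_mul,
        Pi.inv_apply, Matrix.cons_val_one, Matrix.cons_val_zero, mBi_00, mBi_10] at hg ⊢
      omega

/-- The representation. -/
def rho (n : ℕ) : FreeGroup (Fin n) →* SLZ :=
  FreeGroup.lift fun i => mB ^ (i.1 : ℤ) * mP * (mB ^ (i.1 : ℤ))⁻¹

theorem rho_inj (n : ℕ) : Function.Injective (rho n) := by
  let γ : FreeGroup (Fin n) →* FreeGroup (Fin 2) := FreeGroup.lift fun i =>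
    FreeGroup.of 1 ^ (i.1 : ℤ) * FreeGroup.of 0 * (FreeGroup.of 1 ^ (i.1 : ℤ))⁻¹
  have hγ : Function.Injective γ := by
    refine inj_of_sd γ (FreeGroup.lift ![sdP, sdT]) (fun i => FreeGroup.of (i.1 : ℤ)) ?_ ?_
    · have : FreeGroup.lift (fun i : Fin n => FreeGroup.of (i.1 : ℤ)) =
          FreeGroup.map (fun i : Fin n => (i.1 : ℤ)) := by
        ext1 i; simp
      rw [this]
      apply FreeGroup.map_injective
      intro i j hij
      exact Fin.ext (by simpa using hij)
    · intro i
      simp [γ, ← sd_conj]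
  have : rho n = (FreeGroup.lift (![mP, mB] : Fin 2 → SLZ)).comp γ := by
    ext1 i
    simp [rho, γ]
  rw [this, MonoidHom.coe_comp]
  exact sanov_inj.comp hγ

end Rep

section Conv
open Matrix Filter Topology

/-- Action of integer matrices on the real plane. -/
noncomputable def act (A : SLZ) (u : ℝ × ℝ) : ℝ × ℝ :=
  ((A 0 0 : ℝ) * u.1 + (A 0 1 : ℝ) * u.2, (A 1 0 : ℝ) * u.1 + (A 1 1 : ℝ) * u.2)

theorem act_mul (A B : SLZ) (u : ℝ × ℝ) : act (A * B) u = act A (act B u) := by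
  simp only [act, sl_mul, Prod.mk.injEq]
  push_cast
  constructor <;> ring

theorem act_one (u : ℝ × ℝ) : act 1 u = u := by
  have h00 : (1 : SLZ) 0 0 = 1 := rfl
  have h01 : (1 : SLZ) 0 1 = 0 := rfl
  have h10 : (1 : SLZ) 1 0 = 0 := rfl
  have h11 : (1 : SLZ) 1 1 = 1 := rfl
  simp [act, h00, h01, h10, h11]

theorem act_smul (A : SLZ) (c : ℝ) (u : ℝ × ℝ) : act A (c • u) = c • act A u := by
  simp only [act, Prod.smul_fst, Prod.smul_snd, Prod.smul_mk, smul_eq_mul, Prod.mk.injEq]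
  constructor <;> ring

theorem act_sub (A : SLZ) (u v : ℝ × ℝ) : act A (u - v) = act A u - act A v := by
  simp only [act, Prod.fst_sub, Prod.snd_sub, Prod.mk_sub_mk, Prod.mk.injEq]
  constructor <;> ring

theorem act_cont (A : SLZ) : Continuous (act A) := by
  unfold act; fun_prop

noncomputable def dt (u v : ℝ × ℝ) : ℝ := u.1 * v.2 - u.2 * v.1

theorem dt_act (A : SLZ) (u v : ℝ × ℝ) : dt (act A u) (act A v) = dt u v := by
  have h : (A 0 0 : ℝ) * A 1 1 - A 0 1 * A 1 0 = 1 := by exact_mod_cast sl_det A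
  simp only [dt, act]
  linear_combination (u.1 * v.2 - u.2 * v.1) * h

theorem dt_act_inv (A : SLZ) (u v : ℝ × ℝ) : dt (act A u) v = dt u (act A⁻¹ v) := by
  rw [← dt_act A u, ← act_mul, mul_inv_cancel, act_one]

theorem dt_swap (u v : ℝ × ℝ) : dt u v = - dt v u := by
  simp only [dt]; ring

theorem dt_smul_left (c : ℝ) (u v : ℝ × ℝ) : dt (c • u) v = c * dt u v := by
  simp only [dt, Prod.smul_fst, Prod.smul_snd, smul_eq_mul]; ring

theorem dt_cont (v : ℝ × ℝ) : Continuous (fun u => dt u v) := by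
  unfold dt; fun_prop

def Conv (u : ℕ → ℝ × ℝ) (v : ℝ × ℝ) : Prop :=
  ∃ s : ℕ → ℝ, Tendsto (fun k => s k • u k) atTop (𝓝 v)

theorem conv_act (A : SLZ) {u : ℕ → ℝ × ℝ} {v : ℝ × ℝ} (h : Conv u v) :
    Conv (fun k => act A (u k)) (act A v) := by
  obtain ⟨s, hs⟩ := h
  refine ⟨s, ?_⟩
  simp only [← act_smul]
  exact ((act_cont A).tendsto v).comp hs

theorem conv_const (v : ℝ × ℝ) : Conv (fun _ => v) v :=
  ⟨fun _ => 1, by simp⟩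

theorem conv_hyp (M : SLZ) (l : ℝ) (hl : 1 < |l|) (vp vm : ℝ × ℝ) (hp : act M vp = l • vp)
    (hm : act M vm = l⁻¹ • vm) (hd : dt vp vm ≠ 0) {u : ℕ → ℝ × ℝ} {v : ℝ × ℝ}
    (hc : Conv u v) (hv : dt v vm ≠ 0) : Conv (fun k => act (M ^ k) (u k)) vp := by
  obtain ⟨s, hs⟩ := hc
  have hl0 : l ≠ 0 := by rintro rfl; simp at hl; linarith
  have hpow : ∀ (w : ℝ × ℝ) (c : ℝ), act M w = c • w → ∀ k : ℕ, act (M ^ k) w = c ^ k • w := by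
    intro w c h k
    induction k with
    | zero => simp [act_one]
    | succ k ih => rw [pow_succ, act_mul, h, act_smul, ih, smul_smul, pow_succ, mul_comm]
  have hdec : ∀ w : ℝ × ℝ, w = (dt w vm / dt vp vm) • vp - (dt w vp / dt vp vm) • vm := by
    intro w
    have : dt vp vm ≠ 0 := hd
    ext
    · simp only [Prod.fst_sub, Prod.smul_fst, smul_eq_mul]
      field_simp
      simp only [dt]; ring
    · simp only [Prod.snd_sub, Prod.smul_snd, smul_eq_mul]
      field_simp
      simp only [dt]; ring
  refine ⟨fun k => s k * (l ^ k)⁻¹ * dt vp vm / dt v vm, ?_⟩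
  have key : ∀ k, (s k * (l ^ k)⁻¹ * dt vp vm / dt v vm) • act (M ^ k) (u k) =
      (dt (s k • u k) vm / dt v vm) • vp -
        ((l⁻¹ ^ 2) ^ k * dt (s k • u k) vp / dt v vm) • vm := by
    intro k
    have hlk : l ^ k ≠ 0 := pow_ne_zero _ hl0
    conv_lhs => rw [hdec (u k), act_sub, act_smul, act_smul, hpow _ _ hp, hpow _ _ hm]
    simp only [dt_smul_left, smul_sub, smul_smul]
    congr 2
    · field_simp
    · rw [← pow_mul, mul_comm 2 k, pow_mul]
      simp only [inv_pow]
      field_simp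
  simp only [key]
  have t1 : Tendsto (fun k => dt (s k • u k) vm) atTop (𝓝 (dt v vm)) :=
    ((dt_cont vm).tendsto v).comp hs
  have t2 : Tendsto (fun k => dt (s k • u k) vp) atTop (𝓝 (dt v vp)) :=
    ((dt_cont vp).tendsto v).comp hs
  have t3 : Tendsto (fun k : ℕ => (l⁻¹ ^ 2) ^ k) atTop (𝓝 0) := by
    apply tendsto_pow_atTop_nhds_zero_of_abs_lt_one
    rw [abs_pow, abs_inv]
    have : |l|⁻¹ < 1 := inv_lt_one_of_one_lt₀ hl
    exact pow_lt_one₀ (by positivity) this (by norm_num)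
  have t4 := ((t1.div_const (dt v vm)).smul_const vp).sub
    (((t3.mul t2).div_const (dt v vm)).smul_const vm)
  rw [div_self hv] at t4
  simpa using t4

noncomputable def e1 : ℝ × ℝ := (1, 0)
noncomputable def e2 : ℝ × ℝ := (0, 1)

theorem conv_par (M : SLZ) (c : ℝ) (hc0 : c ≠ 0) (hM : ∀ k : ℕ, ∀ w : ℝ × ℝ, act (M ^ k) w =
    (w.1 + c * k * w.2, w.2)) {u : ℕ → ℝ × ℝ} {v : ℝ × ℝ}
    (hc : Conv u v) (hv : dt v e1 ≠ 0) : Conv (fun k => act (M ^ k) (u k)) e1 := by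
  obtain ⟨s, hs⟩ := hc
  have hv2 : v.2 ≠ 0 := by
    intro h; apply hv; simp [dt, e1, h]
  refine ⟨fun k => s k * (c * v.2)⁻¹ * (k : ℝ)⁻¹, ?_⟩
  have h1 : Tendsto (fun k => (s k • u k).1) atTop (𝓝 v.1) := (continuous_fst.tendsto v).comp hs
  have h2 : Tendsto (fun k => (s k • u k).2) atTop (𝓝 v.2) := (continuous_snd.tendsto v).comp hs
  have h3 : Tendsto (fun k : ℕ => ((k : ℝ))⁻¹) atTop (𝓝 0) := tendsto_inv_atTop_nhds_zero_nat
  have hA := ((h1.mul h3).mul_const (c * v.2)⁻¹).add ((h2.const_mul c).mul_const (c * v.2)⁻¹)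
  have hB := (h2.mul h3).mul_const (c * v.2)⁻¹
  have hAB := hA.prodMk_nhds hB
  have : ((v.1 * 0 * (c * v.2)⁻¹ + c * v.2 * (c * v.2)⁻¹, v.2 * 0 * (c * v.2)⁻¹) : ℝ × ℝ) = e1 := by
    have : c * v.2 ≠ 0 := mul_ne_zero hc0 hv2
    rw [mul_inv_cancel₀ this]
    simp [e1]
  rw [this] at hAB
  refine hAB.congr' ?_
  filter_upwards [eventually_gt_atTop 0] with k hk
  have hk' : (k : ℝ) ≠ 0 := by positivity
  rw [hM]
  simp only [Prod.smul_fst, Prod.smul_snd, Prod.smul_mk, smul_eq_mul, Prod.mk.injEq]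
  constructor
  · field_simp
  · ring

end Conv

section Facts
open Matrix Filter Topology

/-- quadratic irrational eigenvalues -/
def IsEig (l : ℝ) : Prop := l ^ 2 + 241 * l + 1 = 0

theorem eig_irr {l : ℝ} (hl : IsEig l) (a b : ℤ) (h : a * l = b) : a = 0 := by
  by_contra ha
  have ha' : (a : ℝ) ≠ 0 := by exact_mod_cast ha
  have hl' : l = ((b / a : ℚ) : ℝ) := by
    push_cast; field_simp; linarith
  have h1 : (2 * l + 241) ^ 2 = 58077 := by
    unfold IsEig at hl; linear_combination 4 * hl
  rw [hl'] at h1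
  have h2 : (2 * (b / a : ℚ) + 241) ^ 2 = 58077 := by exact_mod_cast h1
  have h3 : IsSquare ((58077 : ℕ) : ℚ) := ⟨2 * (b / a : ℚ) + 241, by rw [← sq, h2]; norm_num⟩
  rw [Rat.isSquare_natCast_iff] at h3
  obtain ⟨r, hr⟩ := h3
  have : r < 241 := by nlinarith
  have : 240 < r := by nlinarith
  omega

noncomputable def vv (l : ℝ) : ℝ × ℝ := (93, l + 269)

/-- integer row killing an irrational vector vanishes -/
theorem row_zero {l : ℝ} (hl : IsEig l) (a b : ℤ) (h : (a : ℝ) * (vv l).1 + b * (vv l).2 = 0) :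
    a = 0 ∧ b = 0 := by
  simp only [vv] at h
  have hb : b = 0 := eig_irr hl b (-(93 * a + 269 * b)) (by push_cast; linarith)
  subst hb
  refine ⟨?_, rfl⟩
  have : (a : ℝ) = 0 := by push_cast at h; linarith
  exact_mod_cast this

theorem dt_e1_vv (A : SLZ) {l : ℝ} (hl : IsEig l) : dt (act A e1) (vv l) ≠ 0 := by
  intro h
  have := row_zero hl (-(A 1 0)) (A 0 0) (by
    simp only [dt, act, e1] at h
    push_cast
    linarith)
  have hc := col_ne A
  omega

theorem dt_vv_e1 (A : SLZ) {l : ℝ} (hl : IsEig l) : dt (act A (vv l)) e1 ≠ 0 := by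
  rw [dt_act_inv, dt_swap]
  exact neg_ne_zero.2 (dt_e1_vv _ hl)

variable (n : ℕ) (hn : 3 ≤ n)

theorem rho_p : rho n (xp n hn) = mP := by simp [rho, xp]
theorem rho_q : rho n (xq n hn) = mB * mP * mB⁻¹ := by simp [rho, xq]

def xz : FreeGroup (Fin n) := xp n hn * xq n hn ^ 3

theorem rho_z_entries : (rho n (xz n hn)) 0 0 = -269 ∧ (rho n (xz n hn)) 0 1 = 93 ∧
    (rho n (xz n hn)) 1 0 = -81 ∧ (rho n (xz n hn)) 1 1 = 28 := by
  rw [xz, map_mul, map_pow, rho_p, rho_q]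
  decide

theorem rho_mod (g : FreeGroup (Fin n)) : rho n g ∈ CongruenceSubgroup.Gamma 3 := by
  have : (rho n).range ≤ CongruenceSubgroup.Gamma 3 := by
    apply FreeGroup.range_lift_le
    rintro _ ⟨i, rfl⟩
    apply Subgroup.Normal.conj_mem (CongruenceSubgroup.Gamma_normal 3)
    rw [CongruenceSubgroup.Gamma_mem]
    decide
  exact this ⟨g, rfl⟩

theorem mP_zpow (m : ℤ) : ((mP ^ m) 0 0 = 1 ∧ (mP ^ m) 0 1 = 3 * m) ∧
    (mP ^ m) 1 0 = 0 ∧ (mP ^ m) 1 1 = 1 := by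
  induction m with
  | zero => simp only [zpow_zero]; exact ⟨⟨rfl, rfl⟩, rfl, rfl⟩
  | succ k ih =>
    rw [_root_.zpow_add_one]
    simp only [sl_mul, ih, mP00, mP01, mP10, mP11]
    omega
  | pred k ih =>
    rw [_root_.zpow_sub_one]
    simp only [sl_mul, ih, sl_inv00, sl_inv01, sl_inv10, sl_inv11, mP00, mP01, mP10, mP11]
    omega

theorem sl_ext {A B : SLZ} (h00 : A 0 0 = B 0 0) (h01 : A 0 1 = B 0 1) (h10 : A 1 0 = B 1 0)
    (h11 : A 1 1 = B 1 1) : A = B := by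
  apply Matrix.SpecialLinearGroup.ext
  intro i j
  fin_cases i <;> fin_cases j <;> assumption

theorem fix_e1 (h : FreeGroup (Fin n)) (hd : dt (act (rho n h) e1) e1 = 0) :
    ∃ m : ℤ, h = xp n hn ^ m := by
  have h10 : (rho n h) 1 0 = 0 := by
    simp only [dt, act, e1] at hd
    have : ((rho n h) 1 0 : ℝ) = 0 := by linarith
    exact_mod_cast this
  have hdet := sl_det (rho n h)
  have hmod := rho_mod n h
  rw [CongruenceSubgroup.Gamma_mem] at hmod
  obtain ⟨m00, m01, m10, m11⟩ := hmod
  have m00' : (3 : ℤ) ∣ (rho n h) 0 0 - 1 := by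
    have := (ZMod.intCast_eq_intCast_iff_dvd_sub 1 ((rho n h) 0 0) 3).1 (by rw [m00]; simp)
    exact_mod_cast this
  have m01' : (3 : ℤ) ∣ (rho n h) 0 1 := by
    have := (ZMod.intCast_zmod_eq_zero_iff_dvd ((rho n h) 0 1) 3).1 m01
    exact_mod_cast this
  rw [h10, mul_zero, sub_zero] at hdet
  have h1 := Int.eq_one_or_neg_one_of_mul_eq_one' hdet
  obtain ⟨m, hm⟩ := m01'
  refine ⟨m, rho_inj n ?_⟩
  rw [map_zpow, rho_p]
  obtain ⟨⟨p00, p01⟩, p10, p11⟩ := mP_zpow m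
  apply sl_ext
  · rw [p00]; omega
  · rw [p01, hm]
  · rw [p10, h10]
  · rw [p11]; omega

theorem comm_p (h : FreeGroup (Fin n)) (hc : h * xp n hn = xp n hn * h) :
    ∃ m : ℤ, h = xp n hn ^ m := by
  apply fix_e1 n hn
  have := congrArg (fun g => (rho n g) 1 1) hc
  simp only [map_mul, rho_p, sl_mul, mP00, mP01, mP10, mP11] at this
  have h0 : (rho n h) 1 0 = 0 := by omega
  simp [dt, act, e1, h0]

theorem comm_z (h : FreeGroup (Fin n)) (hc : h * xz n hn = xz n hn * h) :
    ∃ m : ℤ, h = xz n hn ^ m := by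
  let α : FreeGroup (Fin n) →* FreeGroup (Fin n) := FreeGroup.lift fun i =>
    if i.1 = 0 then xp n hn * (xq n hn ^ 3)⁻¹ else FreeGroup.of i
  let α' : FreeGroup (Fin n) →* FreeGroup (Fin n) := FreeGroup.lift fun i =>
    if i.1 = 0 then xp n hn * (xq n hn ^ 3) else FreeGroup.of i
  have ap : α (xp n hn) = xp n hn * (xq n hn ^ 3)⁻¹ := by simp [α, xp]
  have aq : α (xq n hn) = xq n hn := by simp [α, xq]
  have ap' : α' (xp n hn) = xp n hn * (xq n hn ^ 3) := by simp [α', xp]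
  have aq' : α' (xq n hn) = xq n hn := by simp [α', xq]
  have hid : α'.comp α = MonoidHom.id _ := by
    ext1 i
    by_cases hi : i.1 = 0
    · rw [of_zero n hn i hi]
      simp [ap, ap', aq, aq']
    · simp [α, α', hi]
  have haz : α (xz n hn) = xp n hn := by
    simp [xz, ap, aq]
  obtain ⟨m, hm⟩ := comm_p n hn (α h) (by rw [← haz, ← map_mul, hc, map_mul])
  refine ⟨m, ?_⟩
  have := DFunLike.congr_fun hid h
  simp only [MonoidHom.comp_apply, MonoidHom.id_apply, hm, map_zpow, ap'] at this
  exact this.symm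

theorem act_z {l : ℝ} (hl : IsEig l) : act (rho n (xz n hn)) (vv l) = l • vv l := by
  obtain ⟨h00, h01, h10, h11⟩ := rho_z_entries n hn
  simp only [act, h00, h01, h10, h11, vv, Prod.smul_mk, smul_eq_mul, Prod.mk.injEq]
  unfold IsEig at hl
  push_cast
  constructor
  · ring
  · linear_combination -hl

theorem fix_vv (h : FreeGroup (Fin n)) {l : ℝ} (hl : IsEig l)
    (hd : dt (act (rho n h) (vv l)) (vv l) = 0) : ∃ m : ℤ, h = xz n hn ^ m := by
  apply comm_z
  apply rho_inj n
  rw [map_mul, map_mul]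
  have hz := act_z n hn hl
  set A := rho n h with hA
  set Z := rho n (xz n hn) with hZ
  -- `A` scales the vector
  obtain ⟨μ, hμ⟩ : ∃ μ : ℝ, act A (vv l) = μ • vv l := by
    refine ⟨(act A (vv l)).1 / 93, ?_⟩
    have h93 : (vv l).1 = 93 := rfl
    simp only [dt, h93] at hd
    ext
    · simp [h93]
    · simp only [Prod.smul_snd, smul_eq_mul]
      linarith
  have hcomm : act (A * Z) (vv l) = act (Z * A) (vv l) := by
    rw [act_mul, act_mul, hz, hμ, act_smul, act_smul, hz, hμ, smul_smul, smul_smul, mul_comm]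
  simp only [act, Prod.mk.injEq] at hcomm
  obtain ⟨c1, c2⟩ := hcomm
  have r1 := row_zero hl ((A * Z) 0 0 - (Z * A) 0 0) ((A * Z) 0 1 - (Z * A) 0 1)
    (by push_cast; linarith)
  have r2 := row_zero hl ((A * Z) 1 0 - (Z * A) 1 0) ((A * Z) 1 1 - (Z * A) 1 1)
    (by push_cast; linarith)
  apply sl_ext
  · linarith [r1.1]
  · linarith [r1.2]
  · linarith [r2.1]
  · linarith [r2.2]

theorem exists_u0 (L : Set (ℝ × ℝ)) (hL : L.Countable) (hL0 : ∀ v ∈ L, v ≠ 0) :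
    ∃ u0 : ℝ × ℝ, ∀ v ∈ L, ∀ A : SLZ, dt (act A u0) v ≠ 0 := by
  have : Countable L := hL
  have : Countable SLZ := by
    have hi : Function.Injective (fun A : SLZ => (A 0 0, A 0 1, A 1 0, A 1 1)) := by
      intro A B h
      simp only [Prod.mk.injEq] at h
      exact sl_ext h.1 h.2.1 h.2.2.1 h.2.2.2
    exact hi.countable
  have hc : (⋃ p : L × SLZ, {x : ℝ | dt (act p.2 (x, 1)) p.1.1 = 0}).Countable := by
    apply Set.countable_iUnion
    rintro ⟨⟨v, hv⟩, A⟩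
    apply Set.Subsingleton.countable
    intro x hx y hy
    simp only [Set.mem_ofPred_eq] at hx hy
    by_contra hxy
    rw [dt_act_inv] at hx hy
    have hw : act A⁻¹ v = 0 := by
      simp only [dt] at hx hy
      have h2 : (act A⁻¹ v).2 = 0 := by
        have : (x - y) * (act A⁻¹ v).2 = 0 := by linarith
        exact (mul_eq_zero.1 this).resolve_left (sub_ne_zero.2 hxy)
      ext
      · rw [h2] at hx; simp at hx ⊢; exact hx
      · simpa using h2
    apply hL0 v hv
    have h3 : act A (act A⁻¹ v) = v := by rw [← act_mul, mul_inv_cancel, act_one]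
    rw [← h3, hw]
    simp [act]
  obtain ⟨x, hx⟩ : ∃ x : ℝ, x ∉ (⋃ p : L × SLZ, {x : ℝ | dt (act p.2 (x, 1)) p.1.1 = 0}) := by
    by_contra! h
    exact Set.not_countable_univ (hc.mono fun x _ => h x)
  refine ⟨(x, 1), fun v hv A h => hx ?_⟩
  exact Set.mem_iUnion.2 ⟨(⟨v, hv⟩, A), h⟩

end Facts

/-! ### The state machine -/

section Machine
open Matrix Filter Topology

noncomputable def lamP : ℝ := (-241 - √58077) / 2
noncomputable def lamM : ℝ := (-241 + √58077) / 2

theorem sq_s : √(58077 : ℝ) ^ 2 = 58077 := Real.sq_sqrt (by norm_num)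
theorem eigP : IsEig lamP := by
  unfold IsEig lamP; linear_combination sq_s / 4
theorem eigM : IsEig lamM := by
  unfold IsEig lamM; linear_combination sq_s / 4
theorem lam_mul : lamP * lamM = 1 := by
  unfold lamP lamM; linear_combination -sq_s / 4
theorem lam_inv : lamP⁻¹ = lamM := inv_eq_of_mul_eq_one_right lam_mul
theorem lamP_abs : 1 < |lamP| := by
  rw [abs_of_neg]
  · unfold lamP; linarith [Real.sqrt_nonneg 58077]
  · unfold lamP; linarith [Real.sqrt_nonneg 58077]

noncomputable def vP : ℝ × ℝ := vv lamP
noncomputable def vM : ℝ × ℝ := vv lamM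

theorem dt_PM : dt vP vM ≠ 0 := by
  have h : 0 < √(58077 : ℝ) := Real.sqrt_pos.2 (by norm_num)
  have : dt vP vM = 93 * √(58077 : ℝ) := by
    simp only [dt, vP, vM, vv, lamP, lamM]; ring
  rw [this]; positivity

variable (n : ℕ) (hn : 3 ≤ n)

theorem act_zP : act (rho n (xz n hn)) vP = lamP • vP := act_z n hn eigP
theorem act_zM : act (rho n (xz n hn)) vM = lamP⁻¹ • vM := by
  rw [lam_inv]; exact act_z n hn eigM

theorem act_inv_eig (A : SLZ) (l : ℝ) (hl : l ≠ 0) (v : ℝ × ℝ) (h : act A v = l • v) :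
    act A⁻¹ v = l⁻¹ • v := by
  have : act A⁻¹ (act A v) = v := by rw [← act_mul, inv_mul_cancel, act_one]
  rw [h, act_smul] at this
  rw [← this, smul_smul, inv_mul_cancel₀ hl, one_smul, this]

theorem lamP_ne : lamP ≠ 0 := by
  intro h; have := lam_mul; rw [h] at this; simp at this

theorem conv_z {u : ℕ → ℝ × ℝ} {v : ℝ × ℝ} (hc : Conv u v) (hv : dt v vM ≠ 0) :
    Conv (fun k => act (rho n (xz n hn ^ k)) (u k)) vP := by
  simp only [map_pow]
  exact conv_hyp _ lamP lamP_abs vP vM (act_zP n hn) (act_zM n hn) dt_PM hc hv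

theorem conv_zi {u : ℕ → ℝ × ℝ} {v : ℝ × ℝ} (hc : Conv u v) (hv : dt v vP ≠ 0) :
    Conv (fun k => act (rho n ((xz n hn ^ k)⁻¹)) (u k)) vM := by
  simp only [map_inv, map_pow, ← inv_pow]
  refine conv_hyp _ lamP lamP_abs vM vP ?_ ?_ ?_ hc hv
  · rw [act_inv_eig _ _ (inv_ne_zero lamP_ne) _ (act_zM n hn), inv_inv]
  · rw [act_inv_eig _ _ lamP_ne _ (act_zP n hn)]
  · rw [dt_swap]; exact neg_ne_zero.2 dt_PM

theorem conv_p {u : ℕ → ℝ × ℝ} {v : ℝ × ℝ} (hc : Conv u v) (hv : dt v e1 ≠ 0) :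
    Conv (fun k => act (rho n (xp n hn ^ k)) (u k)) e1 := by
  simp only [map_pow, rho_p]
  refine conv_par _ 3 (by norm_num) ?_ hc hv
  intro k w
  obtain ⟨⟨h1, h2⟩, h3, h4⟩ := mP_zpow k
  rw [zpow_natCast] at h1 h2 h3 h4
  simp only [act, h1, h2, h3, h4]
  push_cast
  simp

theorem conv_pi {u : ℕ → ℝ × ℝ} {v : ℝ × ℝ} (hc : Conv u v) (hv : dt v e1 ≠ 0) :
    Conv (fun k => act (rho n ((xp n hn ^ k)⁻¹)) (u k)) e1 := by
  simp only [map_inv, map_pow, rho_p, ← inv_pow]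
  refine conv_par _ (-3) (by norm_num) ?_ hc hv
  intro k w
  obtain ⟨⟨h1, h2⟩, h3, h4⟩ := mP_zpow (-k)
  rw [_root_.zpow_neg, zpow_natCast, ← inv_pow] at h1 h2 h3 h4
  simp only [act, h1, h2, h3, h4]
  push_cast
  simp

/-! the auxiliary representation -/

def mQ : SLZ := ⟨!![0, -1; 1, -1], by simp [det_fin_two]⟩

def theta : FreeGroup (Fin n) →* SLZ :=
  FreeGroup.lift fun i => if i.1 = 0 then mP else if i.1 = 1 then mQ else 1

theorem theta_p : theta n (xp n hn) = mP := by simp [theta, xp]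
theorem theta_q : theta n (xq n hn) = mQ := by simp [theta, xq]

/-- the conjugate of `z` by `q` -/
def xz' : FreeGroup (Fin n) := xq n hn * xz n hn * (xq n hn)⁻¹

theorem mQ00 : mQ 0 0 = 0 := rfl
theorem mQ01 : mQ 0 1 = -1 := rfl
theorem mQ10 : mQ 1 0 = 1 := rfl
theorem mQ11 : mQ 1 1 = -1 := rfl

theorem theta_z' : theta n (xz' n hn) = mQ * mP * mQ⁻¹ := by
  have h3 : mQ ^ 3 = 1 := by decide
  rw [xz', xz]
  simp [theta_p, theta_q, h3]

theorem theta_p_zpow (m : ℤ) (w : ℝ × ℝ) :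
    act (theta n (xp n hn ^ m)) w = (w.1 + 3 * m * w.2, w.2) := by
  rw [map_zpow, theta_p]
  obtain ⟨⟨h1, h2⟩, h3, h4⟩ := mP_zpow m
  simp only [act, h1, h2, h3, h4]
  push_cast
  simp

theorem theta_z'_zpow (m : ℤ) (w : ℝ × ℝ) :
    act (theta n (xz' n hn ^ m)) w = (w.1, w.2 - 3 * m * w.1) := by
  rw [map_zpow, theta_z', conj_zpow]
  obtain ⟨⟨h1, h2⟩, h3, h4⟩ := mP_zpow m
  simp only [act, sl_mul, sl_inv00, sl_inv01, sl_inv10, sl_inv11, mQ00, mQ01, mQ10, mQ11,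
    h1, h2, h3, h4, Prod.mk.injEq]
  push_cast
  constructor <;> ring

def Hx (w : ℝ × ℝ) : Prop := |w.2| < |w.1|
def Hy (w : ℝ × ℝ) : Prop := |w.1| < |w.2|

theorem pp_aux (x y : ℝ) (m : ℤ) (hm : m ≠ 0) (h : |x| < |y|) : |y| < |x + 3 * m * y| := by
  have h1 : (1 : ℝ) ≤ |(m : ℝ)| := by
    have := Int.one_le_abs hm
    exact_mod_cast this
  have h2 : |3 * (m : ℝ) * y| = 3 * |(m : ℝ)| * |y| := by
    rw [abs_mul, abs_mul]; norm_num
  have h3 : |3 * (m : ℝ) * y| ≤ |x + 3 * m * y| + |x| := by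
    have := abs_sub (x + 3 * m * y) x
    simpa using this
  nlinarith [abs_nonneg y, abs_nonneg x]

theorem pp_p (m : ℤ) (hm : m ≠ 0) (h : FreeGroup (Fin n)) (w : ℝ × ℝ)
    (hw : Hy (act (theta n h) w)) : Hx (act (theta n (xp n hn ^ m * h)) w) := by
  rw [map_mul, act_mul, theta_p_zpow]
  exact pp_aux _ _ m hm hw

theorem pp_z' (m : ℤ) (hm : m ≠ 0) (h : FreeGroup (Fin n)) (w : ℝ × ℝ)
    (hw : Hx (act (theta n h) w)) : Hy (act (theta n (xz' n hn ^ m * h)) w) := by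
  rw [map_mul, act_mul, theta_z'_zpow]
  have := pp_aux _ _ (-m) (neg_ne_zero.2 hm) hw
  simp only [Hy]
  push_cast at this
  convert this using 2
  ring

/-- The state attached to a sequence whose leading letter is `t` (`true`) or `t⁻¹` (`false`). -/
def St (u0 : ℝ × ℝ) (e : Bool) (V : ℕ → FreeGroup (Fin n)) : Prop :=
  ∃ (h : FreeGroup (Fin n)) (Y : ℕ → FreeGroup (Fin n)),
    if e then
      (∀ k, V k = xz n hn ^ k * (xq n hn)⁻¹ * h * Y k) ∧
      ((Conv (fun k => act (rho n (Y k)) u0) e1 ∧ Hx (act (theta n h) e1)) ∨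
       (Conv (fun k => act (rho n (Y k)) u0) (act (rho n (xq n hn)) vM) ∧
          Hx (act (theta n h) e2)))
    else
      (∀ k, V k = (xp n hn ^ k)⁻¹ * h * Y k) ∧
      ((Conv (fun k => act (rho n (Y k)) u0) e1 ∧ Hy (act (theta n h) e1)) ∨
       (Conv (fun k => act (rho n (Y k)) u0) (act (rho n (xq n hn)) vM) ∧
          Hy (act (theta n h) e2)))

theorem not_zM (h : FreeGroup (Fin n)) (hx : Hx (act (theta n h) e2)) :
    dt (act (rho n ((xq n hn)⁻¹ * h * xq n hn)) vM) vM ≠ 0 := by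
  intro h0
  obtain ⟨m, hm⟩ := fix_vv n hn _ eigM h0
  have : h = xz' n hn ^ m := by
    rw [xz', conj_zpow, ← hm]; group
  rw [this, theta_z'_zpow] at hx
  simp [Hx, e2] at hx
  linarith

theorem not_pe (n : ℕ) (hn : 3 ≤ n) (h : FreeGroup (Fin n)) (hx : Hy (act (theta n h) e1)) :
    dt (act (rho n h) e1) e1 ≠ 0 := by
  intro h0
  obtain ⟨m, hm⟩ := fix_e1 n hn _ h0
  rw [hm, theta_p_zpow] at hx
  simp [Hy, e1] at hx
  linarith

noncomputable def limv (e : Bool) : ℝ × ℝ := if e then vP else e1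

theorem St_lim (u0 : ℝ × ℝ) (e : Bool) (V : ℕ → FreeGroup (Fin n)) (h : St n hn u0 e V) :
    Conv (fun k => act (rho n (V k)) u0) (limv e) := by
  obtain ⟨h, Y, hY⟩ := h
  cases e with
  | true =>
    simp only [if_true] at hY
    obtain ⟨hV, hY⟩ := hY
    have e : ∀ k, act (rho n (V k)) u0 = act (rho n (xz n hn ^ k))
        (act (rho n ((xq n hn)⁻¹ * h)) (act (rho n (Y k)) u0)) := by
      intro k
      rw [hV]; simp only [map_mul, act_mul]
    simp only [e, limv, if_true]
    rcases hY with ⟨hc, hx⟩ | ⟨hc, hx⟩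
    · exact conv_z n hn (conv_act _ hc) (dt_e1_vv _ eigM)
    · refine conv_z n hn (conv_act _ hc) ?_
      rw [← act_mul, ← map_mul]
      exact not_zM n hn h hx
  | false =>
    simp only [Bool.false_eq_true, if_false] at hY
    obtain ⟨hV, hY⟩ := hY
    have e : ∀ k, act (rho n (V k)) u0 = act (rho n ((xp n hn ^ k)⁻¹))
        (act (rho n h) (act (rho n (Y k)) u0)) := by
      intro k
      rw [hV]; simp only [map_mul, act_mul]
    simp only [e, limv, Bool.false_eq_true, if_false]
    rcases hY with ⟨hc, hx⟩ | ⟨hc, hx⟩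
    · exact conv_pi n hn (conv_act _ hc) (not_pe n hn h hx)
    · refine conv_pi n hn (conv_act _ hc) ?_
      rw [← act_mul]
      exact dt_vv_e1 _ eigM

/-- The image of the letter `t` or its inverse. -/
def Tk (e : Bool) (k : ℕ) : FreeGroup (Fin n) :=
  if e then xz n hn ^ k * (xq n hn)⁻¹ * xp n hn ^ k else
    (xz n hn ^ k * (xq n hn)⁻¹ * xp n hn ^ k)⁻¹

theorem St_plus (u0 : ℝ × ℝ) (W : ℕ → FreeGroup (Fin n)) (v : ℝ × ℝ)
    (hc : Conv (fun k => act (rho n (W k)) u0) v) (hv : dt v e1 ≠ 0) :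
    St n hn u0 true (fun k => Tk n hn true k * W k) := by
  refine ⟨1, fun k => xp n hn ^ k * W k, ?_⟩
  simp only [if_true]
  refine ⟨fun k => by simp only [Tk, if_true]; group, Or.inl ⟨?_, ?_⟩⟩
  · simp only [map_mul, act_mul]
    exact conv_p n hn hc hv
  · rw [map_one, act_one]; simp [Hx, e1]

theorem St_minus (u0 : ℝ × ℝ) (W : ℕ → FreeGroup (Fin n)) (v : ℝ × ℝ)
    (hc : Conv (fun k => act (rho n (W k)) u0) v) (hv : dt v vP ≠ 0) :
    St n hn u0 false (fun k => Tk n hn false k * W k) := by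
  refine ⟨1, fun k => xq n hn * ((xz n hn ^ k)⁻¹ * W k), ?_⟩
  simp only [Bool.false_eq_true, if_false]
  refine ⟨fun k => by simp only [Tk, Bool.false_eq_true, if_false]; group, Or.inr ⟨?_, ?_⟩⟩
  · simp only [map_mul, act_mul]
    exact conv_act _ (conv_zi n hn hc hv)
  · rw [map_one, act_one]; simp [Hy, e2]

theorem St_trans (u0 : ℝ × ℝ) (e e' : Bool) (V : ℕ → FreeGroup (Fin n))
    (hV : St n hn u0 e V) (a : FreeGroup (Fin n)) (ha : a = 1 → e' = e) :
    St n hn u0 e' (fun k => Tk n hn e' k * (a * V k)) := by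
  have hlim := conv_act (rho n a) (St_lim n hn u0 e V hV)
  simp only [← act_mul, ← map_mul] at hlim
  cases e with
  | true =>
    cases e' with
    | true => exact St_plus n hn u0 _ _ hlim (dt_vv_e1 _ eigP)
    | false =>
      by_cases h0 : dt (act (rho n a) (limv true)) vP = 0
      · obtain ⟨m, rfl⟩ := fix_vv n hn a eigP h0
        have hm : m ≠ 0 := by
          rintro rfl
          simpa using ha (zpow_zero _)
        obtain ⟨h, Y, hY⟩ := hV
        simp only [if_true] at hY
        refine ⟨xz' n hn ^ m * h, Y, ?_⟩
        simp only [Bool.false_eq_true, if_false]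
        refine ⟨fun k => ?_, ?_⟩
        · rw [hY.1 k, xz', conj_zpow]
          simp only [Tk, Bool.false_eq_true, if_false]
          group
        · exact hY.2.imp (fun hh => ⟨hh.1, pp_z' n hn m hm h _ hh.2⟩)
            (fun hh => ⟨hh.1, pp_z' n hn m hm h _ hh.2⟩)
      · exact St_minus n hn u0 _ _ hlim h0
  | false =>
    cases e' with
    | false => exact St_minus n hn u0 _ _ hlim (dt_e1_vv _ eigP)
    | true =>
      by_cases h0 : dt (act (rho n a) (limv false)) e1 = 0
      · obtain ⟨m, rfl⟩ := fix_e1 n hn a h0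
        have hm : m ≠ 0 := by
          rintro rfl
          simpa using ha (zpow_zero _)
        obtain ⟨h, Y, hY⟩ := hV
        simp only [Bool.false_eq_true, if_false] at hY
        refine ⟨xp n hn ^ m * h, Y, ?_⟩
        simp only [if_true]
        refine ⟨fun k => ?_, ?_⟩
        · rw [hY.1 k]
          simp only [Tk, if_true]
          group
        · exact hY.2.imp (fun hh => ⟨hh.1, pp_p n hn m hm h _ hh.2⟩)
            (fun hh => ⟨hh.1, pp_p n hn m hm h _ hh.2⟩)
      · exact St_plus n hn u0 _ _ hlim h0

/-- The discriminating sequence. -/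
def fk (k : ℕ) : FreeGroup (Fin n) →* FreeGroup (Fin n) :=
  FreeGroup.lift fun i => if i.1 = 2 then Tk n hn true k else FreeGroup.of i

theorem fk_letter (k : ℕ) (x : Fin n × Bool) (hx : x.1.1 ≠ 2) :
    fk n hn k (FreeGroup.mk [x]) = FreeGroup.mk [x] := by
  obtain ⟨i, e⟩ := x
  have : fk n hn k (FreeGroup.of i) = FreeGroup.of i := by
    simp only [fk, FreeGroup.lift_apply_of]; rw [if_neg hx]
  cases e with
  | true => exact this
  | false =>
    have h2 : FreeGroup.mk [(i, false)] = (FreeGroup.of i)⁻¹ := rfl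
    rw [h2, map_inv, this]

theorem fk_t (k : ℕ) (x : Fin n × Bool) (hx : x.1.1 = 2) :
    fk n hn k (FreeGroup.mk [x]) = Tk n hn x.2 k := by
  obtain ⟨i, e⟩ := x
  have : fk n hn k (FreeGroup.of i) = Tk n hn true k := by
    simp only [fk, FreeGroup.lift_apply_of]; rw [if_pos hx]
  cases e with
  | true => exact this
  | false =>
    have h2 : FreeGroup.mk [(i, false)] = (FreeGroup.of i)⁻¹ := rfl
    rw [h2, map_inv, this]
    simp [Tk]

theorem mk_cons (x : Fin n × Bool) (L : List (Fin n × Bool)) :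
    FreeGroup.mk (x :: L) = FreeGroup.mk [x] * FreeGroup.mk L := by
  rw [FreeGroup.mul_mk]; rfl

theorem fk_free (k : ℕ) (L : List (Fin n × Bool)) (hL : ∀ x ∈ L, x.1.1 ≠ 2) :
    fk n hn k (FreeGroup.mk L) = FreeGroup.mk L := by
  induction L with
  | nil => exact map_one _
  | cons x L ih =>
    rw [mk_cons, map_mul, fk_letter n hn k x (hL x (by simp)),
      ih (fun y hy => hL y (by simp [hy]))]

theorem red_ne_one {L : List (Fin n × Bool)} (h : FreeGroup.IsReduced L)
    (h1 : FreeGroup.mk L = 1) : L = [] := by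
  have h2 : FreeGroup.reduce L = FreeGroup.reduce [] := FreeGroup.reduce.sound h1
  rw [h.reduce_eq] at h2
  exact h2

theorem machine (u0 : ℝ × ℝ) (hu : ∀ v ∈ ({e1, vP} : Set (ℝ × ℝ)), ∀ A : SLZ, dt (act A u0) v ≠ 0)
    (L : List (Fin n × Bool)) (hL : FreeGroup.IsReduced L) :
    (∀ x ∈ L, x.1.1 ≠ 2) ∨ ∃ La x L', L = La ++ x :: L' ∧ (∀ y ∈ La, y.1.1 ≠ 2) ∧ x.1.1 = 2 ∧
      St n hn u0 x.2 (fun k => fk n hn k (FreeGroup.mk (x :: L'))) := by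
  induction L with
  | nil => left; simp
  | cons x L ih =>
    have hL' : FreeGroup.IsReduced L := hL.infix ⟨[x], [], by simp⟩
    by_cases hx : x.1.1 = 2
    · right
      refine ⟨[], x, L, rfl, by simp, hx, ?_⟩
      have e : ∀ k, fk n hn k (FreeGroup.mk (x :: L)) =
          Tk n hn x.2 k * fk n hn k (FreeGroup.mk L) := by
        intro k; rw [mk_cons, map_mul, fk_t n hn k x hx]
      simp only [e]
      rcases ih hL' with hfree | ⟨La, y, L', rfl, hLa, hy, hS⟩
      · have e2 : ∀ k, fk n hn k (FreeGroup.mk L) = FreeGroup.mk L := fun k => fk_free n hn k L hfree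
        simp only [e2]
        cases x.2 with
        | true => exact St_plus n hn u0 _ _ (conv_const _) (hu e1 (by simp) _)
        | false => exact St_minus n hn u0 _ _ (conv_const _) (hu vP (by simp) _)
      · have e2 : ∀ k, fk n hn k (FreeGroup.mk (La ++ y :: L')) =
            FreeGroup.mk La * fk n hn k (FreeGroup.mk (y :: L')) := by
          intro k
          rw [← FreeGroup.mul_mk, map_mul, fk_free n hn k La hLa]
        simp only [e2]
        refine St_trans n hn u0 y.2 x.2 _ hS _ ?_
        intro h1
        have hLa' : La = [] := red_ne_one n (hL'.infix ⟨[], y :: L', by simp⟩) h1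
        subst hLa'
        rw [List.nil_append, FreeGroup.isReduced_cons_cons] at hL
        exact hL.1 (Fin.ext (hx.trans hy.symm))
    · rcases ih hL' with hfree | ⟨La, y, L', rfl, hLa, hy, hS⟩
      · left
        intro z hz
        rcases List.mem_cons.1 hz with rfl | hz
        · exact hx
        · exact hfree z hz
      · right
        refine ⟨x :: La, y, L', rfl, ?_, hy, hS⟩
        intro z hz
        rcases List.mem_cons.1 hz with rfl | hz
        · exact hx
        · exact hLa z hz

theorem fk_discr (g : FreeGroup (Fin n)) (hg : g ≠ 1) : ∀ᶠ k in atTop, fk n hn k g ≠ 1 := by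
  obtain ⟨u0, hu⟩ := exists_u0 {e1, vP} (Set.toFinite _).countable (by
    intro v hv
    rcases hv with rfl | rfl
    · simp [e1]
    · simp [vP, vv])
  have hr : FreeGroup.IsReduced g.toWord := FreeGroup.isReduced_toWord
  rcases machine n hn u0 hu g.toWord hr with hfree | ⟨La, x, L', hw, hLa, hx, hS⟩
  · refine Eventually.of_forall fun k => ?_
    have := fk_free n hn k _ hfree
    rw [FreeGroup.mk_toWord] at this
    rwa [this]
  · have hlim := conv_act (rho n (FreeGroup.mk La)) (St_lim n hn u0 _ _ hS)
    have e : ∀ k, fk n hn k g =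
        FreeGroup.mk La * fk n hn k (FreeGroup.mk (x :: L')) := by
      intro k
      rw [← FreeGroup.mk_toWord (x := g), hw, ← FreeGroup.mul_mk, map_mul, fk_free n hn k La hLa]
    simp only [← act_mul, ← map_mul, ← e] at hlim
    obtain ⟨s, hs⟩ := hlim
    set w := act (rho n (FreeGroup.mk La)) (limv x.2) with hw'
    have hne : dt w u0 ≠ 0 := by
      rw [hw', dt_act_inv, dt_swap]
      apply neg_ne_zero.2
      cases x.2 with
      | true => exact hu _ (by simp [limv]) _
      | false => exact hu _ (by simp [limv]) _
    have ht : Tendsto (fun k => dt (s k • act (rho n (fk n hn k g)) u0) u0) atTop (𝓝 (dt w u0)) :=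
      ((dt_cont u0).tendsto w).comp hs
    filter_upwards [ht.eventually_ne hne] with k hk h1
    apply hk
    rw [h1, map_one, act_one, dt_smul_left]
    simp [dt, mul_comm]

/-- The conjugated sequence sends `elB` to `elA`. -/
def fk' (k : ℕ) : FreeGroup (Fin n) →* FreeGroup (Fin n) :=
  (MulAut.conj (xp n hn ^ k)).toMonoidHom.comp (fk n hn k)

theorem fk'_B (k : ℕ) : fk' n hn k (elB n hn) = elA n hn := by
  have hp : fk n hn k (xp n hn) = xp n hn := by simp [fk, xp]
  have hq : fk n hn k (xq n hn) = xq n hn := by simp [fk, xq]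
  have ht : fk n hn k (xt n hn) = xz n hn ^ k * (xq n hn)⁻¹ * xp n hn ^ k := by
    simp [fk, xt, Tk]
  have hz : (xz n hn ^ k)⁻¹ * (xp n hn * xq n hn ^ 3) * xz n hn ^ k = xp n hn * xq n hn ^ 3 := by
    change (xz n hn ^ k)⁻¹ * xz n hn * xz n hn ^ k = xz n hn
    group
  have h1 : fk' n hn k (elB n hn) = xp n hn ^ k * (xp n hn *
      ((xp n hn ^ k)⁻¹ * xq n hn * ((xz n hn ^ k)⁻¹ * (xp n hn * xq n hn ^ 3) * xz n hn ^ k) *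
        (xq n hn)⁻¹ * xp n hn ^ k)) * (xp n hn ^ k)⁻¹ := by
    change xp n hn ^ k * fk n hn k (elB n hn) * (xp n hn ^ k)⁻¹ = _
    simp only [elB, map_mul, map_inv, map_pow, hp, hq, ht]
    group
  rw [h1, hz, elA]
  group

theorem fk'_discr (g : FreeGroup (Fin n)) (hg : g ≠ 1) : ∀ᶠ k in atTop, fk' n hn k g ≠ 1 := by
  filter_upwards [fk_discr n hn g hg] with k hk h
  apply hk
  simpa [fk'] using h

end Machine

/-- For every finite `n ≥ 3`, the free group of rank `n` is not `∀`-homogeneous: there are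
finite tuples `a` and `b` of the same length with the same `∀`-type such that no automorphism
sends `a` to `b`. -/
theorem freeGroup_finite_rank_not_forall_homogeneous (n : ℕ) (hn : 3 ≤ n) :
    ∃ (k : ℕ) (a b : Fin k → FreeGroup (Fin n)),
      (∀ φ : Lgp.Formula (Fin k), IsUniversalF φ → (φ.Realize a ↔ φ.Realize b)) ∧
      ¬ ∃ e : FreeGroup (Fin n) ≃* FreeGroup (Fin n), ∀ i, e (a i) = b i := by
  refine ⟨1, fun _ => elA n hn, fun _ => elB n hn, ?_, ?_⟩
  · intro φ hφ
    constructor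
    · exact univ_transfer (fk' n hn) (fk'_discr n hn) _ _ (fun k _ => fk'_B n hn k) φ hφ
    · obtain ⟨f, hf, hfa⟩ := exists_inj n hn
      refine univ_transfer (fun _ => f) ?_ _ _ (fun _ _ => hfa) φ hφ
      intro g hg
      refine Filter.Eventually.of_forall fun _ h => hg ?_
      exact hf (h.trans (map_one f).symm)
  · rintro ⟨e, he⟩
    exact no_auto n hn e (he 0)
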